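/- Let H_K be an RKHS with kernel K, S_T = span{e_1,...,e_n} for orthonormal e_j, and X_n = {x_1,...,x_n} points such that K[X_n] is nonsingular and the matrix E = [e_k(x_j) : 1 ≤ j,k ≤ n] is nonsingular. Then dist(S_X, S_T) = sqrt(1 - 1/λ_max(K[X_n]^T (E E*)^{-1})), where S_X = span{K(x_j,·)} and dist is the operator-norm distance between orthogonal projections. -/

import Mathlib

open scoped RealInnerProductSpace

section OrthogonalProjections

variable {H : Type*} [NormedAddCommGroup H] [InnerProductSpace ℝ H]

/-- The operator `P` is the orthogonal projection onto `U`. -/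
def IsOrthProj (U : Submodule ℝ H) (P : H →L[ℝ] H) : Prop :=
  ∀ v : H, P v ∈ U ∧ ∀ w ∈ U, ⟪v - P v, w⟫ = 0

namespace IsOrthProj

variable {U V : Submodule ℝ H} {P Q : H →L[ℝ] H}

lemma inner_apply_left (hP : IsOrthProj U P) (v : H) {w : H} (hw : w ∈ U) :
    ⟪P v, w⟫ = ⟪v, w⟫ := by
  have h := (hP v).2 w hw
  rw [inner_sub_left] at h
  linarith

lemma apply_eq (hP : IsOrthProj U P) {v p : H} (hp : p ∈ U) (h : ∀ w ∈ U, ⟪v, w⟫ = ⟪p, w⟫) :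
    P v = p := by
  have hU : P v - p ∈ U := U.sub_mem (hP v).1 hp
  rw [← sub_eq_zero, ← inner_self_eq_zero (𝕜 := ℝ), inner_sub_left,
    hP.inner_apply_left v hU, h _ hU, sub_self]

lemma apply_of_mem (hP : IsOrthProj U P) {v : H} (hv : v ∈ U) : P v = v :=
  hP.apply_eq hv fun _ _ => rfl

lemma norm_sq_eq (hP : IsOrthProj U P) (v : H) : ‖v‖ ^ 2 = ‖P v‖ ^ 2 + ‖v - P v‖ ^ 2 := by
  have h := (hP v).2 (P v) (hP v).1
  have h2 := norm_add_sq_real (v - P v) (P v)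
  rw [sub_add_cancel, h] at h2
  linarith

/-- If `Q` maps `U` onto `V` with `‖f‖² ≤ c ‖Q f‖²` on `U`, then `‖g‖² ≤ c ‖P g‖²` on `V`. -/
lemma norm_sq_le_swap (hP : IsOrthProj U P) (hQ : IsOrthProj V Q) {c : ℝ}
    (hle : ∀ f ∈ U, ‖f‖ ^ 2 ≤ c * ‖Q f‖ ^ 2) (hsurj : ∀ g ∈ V, ∃ f ∈ U, Q f = g)
    {g : H} (hg : g ∈ V) : ‖g‖ ^ 2 ≤ c * ‖P g‖ ^ 2 := by
  obtain ⟨f, hf, rfl⟩ := hsurj g hg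
  have h1 : ‖Q f‖ ^ 2 ≤ ‖P (Q f)‖ * ‖f‖ := by
    rw [← real_inner_self_eq_norm_sq, hQ.inner_apply_left f hg, real_inner_comm,
      ← hP.inner_apply_left _ hf]
    exact real_inner_le_norm _ _
  rcases (norm_nonneg (Q f)).eq_or_lt with h0 | h0
  · simp [norm_eq_zero.1 h0.symm]
  · refine le_of_mul_le_mul_right ?_ (pow_pos h0 2)
    calc ‖Q f‖ ^ 2 * ‖Q f‖ ^ 2 ≤ (‖P (Q f)‖ * ‖f‖) * (‖P (Q f)‖ * ‖f‖) := by gcongr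
      _ = ‖P (Q f)‖ ^ 2 * ‖f‖ ^ 2 := by ring
      _ ≤ ‖P (Q f)‖ ^ 2 * (c * ‖Q f‖ ^ 2) := by gcongr; exact hle f hf
      _ = c * ‖P (Q f)‖ ^ 2 * ‖Q f‖ ^ 2 := by ring

lemma norm_sub_sq_le (hQ : IsOrthProj V Q) {c : ℝ} (hc : 0 < c) {f : H}
    (h : ‖f‖ ^ 2 ≤ c * ‖Q f‖ ^ 2) : ‖f - Q f‖ ^ 2 ≤ (1 - 1 / c) * ‖f‖ ^ 2 := by
  have h1 := hQ.norm_sq_eq f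
  have h2 : 1 / c * ‖f‖ ^ 2 ≤ ‖Q f‖ ^ 2 := by
    rw [one_div, inv_mul_le_iff₀ hc]
    exact h
  linarith

theorem norm_sub_eq (hP : IsOrthProj U P) (hQ : IsOrthProj V Q) {c : ℝ}
    (hle : ∀ f ∈ U, ‖f‖ ^ 2 ≤ c * ‖Q f‖ ^ 2) (hsurj : ∀ g ∈ V, ∃ f ∈ U, Q f = g)
    (hmax : ∃ f ∈ U, f ≠ 0 ∧ ‖f‖ ^ 2 = c * ‖Q f‖ ^ 2) :
    ‖P - Q‖ = Real.sqrt (1 - 1 / c) := by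
  obtain ⟨f, hfU, hf0, hf⟩ := hmax
  have hfpos : 0 < ‖f‖ ^ 2 := by positivity
  have hc : 0 < c := pos_of_mul_pos_left (hf ▸ hfpos) (sq_nonneg _)
  have hdiff : ‖f - Q f‖ ^ 2 = (1 - 1 / c) * ‖f‖ ^ 2 := by
    have h1 := hQ.norm_sq_eq f
    have h2 : 1 / c * ‖f‖ ^ 2 = ‖Q f‖ ^ 2 := by
      rw [hf]
      field_simp
    linarith
  have hs : 0 ≤ 1 - 1 / c :=
    nonneg_of_mul_nonneg_left (hdiff ▸ sq_nonneg _) hfpos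
  apply le_antisymm
  · refine ContinuousLinearMap.opNorm_le_bound _ (Real.sqrt_nonneg _) fun v => ?_
    refine le_of_sq_le_sq ?_ (by positivity)
    rw [mul_pow, Real.sq_sqrt hs]
    set w := v - P v with hw
    have hQw : ‖Q w‖ ^ 2 ≤ (1 - 1 / c) * ‖w‖ ^ 2 := by
      have h1 : ‖Q w‖ ^ 2 ≤ ‖w‖ * ‖Q w - P (Q w)‖ := by
        have h2 : ⟪w, P (Q w)⟫ = 0 := (hP v).2 _ (hP _).1
        have h3 : ‖Q w‖ ^ 2 = ⟪w, Q w - P (Q w)⟫ := by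
          rw [inner_sub_right, h2, sub_zero, ← hQ.inner_apply_left w (hQ w).1,
            real_inner_self_eq_norm_sq]
        exact h3 ▸ real_inner_le_norm _ _
      have h4 := hP.norm_sub_sq_le hc (hP.norm_sq_le_swap hQ hle hsurj (hQ w).1)
      rcases (norm_nonneg (Q w)).eq_or_lt with h0 | h0
      · rw [← h0, zero_pow two_ne_zero]
        exact mul_nonneg hs (sq_nonneg _)
      · refine le_of_mul_le_mul_right ?_ (pow_pos h0 2)
        calc ‖Q w‖ ^ 2 * ‖Q w‖ ^ 2
            ≤ (‖w‖ * ‖Q w - P (Q w)‖) * (‖w‖ * ‖Q w - P (Q w)‖) := by gcongr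
          _ = ‖w‖ ^ 2 * ‖Q w - P (Q w)‖ ^ 2 := by ring
          _ ≤ ‖w‖ ^ 2 * ((1 - 1 / c) * ‖Q w‖ ^ 2) := by gcongr
          _ = (1 - 1 / c) * ‖w‖ ^ 2 * ‖Q w‖ ^ 2 := by ring
    have hPv := hQ.norm_sub_sq_le hc (hle (P v) (hP v).1)
    have hsplit : (P - Q) v = (P v - Q (P v)) - Q w := by
      simp [hw]
    have horth : ⟪P v - Q (P v), Q w⟫ = 0 := (hQ (P v)).2 _ (hQ w).1
    rw [hsplit, norm_sub_sq_real, horth, hP.norm_sq_eq v, ← hw]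
    linarith
  · have h := (P - Q).le_opNorm f
    rw [sub_apply, hP.apply_of_mem hfU] at h
    refine Real.sqrt_le_iff.2 ⟨norm_nonneg _, le_of_mul_le_mul_right ?_ hfpos⟩
    rw [← hdiff, ← mul_pow]
    gcongr

end IsOrthProj

end OrthogonalProjections

section Matrices

open Matrix

variable {m : Type*} [Fintype m] [DecidableEq m]

/-- The eigenvalues of `A (E Eᴴ)⁻¹` are those of the generalized problem `A u = r E Eᵀ u`. -/
lemma exists_mulVec_mul_inv_eq_smul_iff (A E : Matrix m m ℝ) (hE : IsUnit E.det) (r : ℝ) :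
    (∃ v : m → ℝ, v ≠ 0 ∧ (A * (E * Eᴴ)⁻¹) *ᵥ v = r • v) ↔
      ∃ u : m → ℝ, u ≠ 0 ∧ A *ᵥ u = r • (E *ᵥ (u ᵥ* E)) := by
  have hG : IsUnit (E * Eᴴ).det := by
    simpa [Matrix.det_mul, Matrix.det_conjTranspose] using hE
  have key : ∀ u, (E * Eᴴ) *ᵥ u = E *ᵥ (u ᵥ* E) := fun u => by
    rw [← mulVec_mulVec, conjTranspose_eq_transpose_of_trivial, mulVec_transpose]
  constructor
  · rintro ⟨v, hv, h⟩
    have hv' : (E * Eᴴ) *ᵥ ((E * Eᴴ)⁻¹ *ᵥ v) = v := by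
      rw [mulVec_mulVec, mul_nonsing_inv _ hG, one_mulVec]
    refine ⟨(E * Eᴴ)⁻¹ *ᵥ v, fun h0 => hv ?_, ?_⟩
    · rw [← hv', h0, mulVec_zero]
    · rw [← key, hv', mulVec_mulVec, h]
  · rintro ⟨u, hu, h⟩
    have hu' : (E * Eᴴ)⁻¹ *ᵥ ((E * Eᴴ) *ᵥ u) = u := by
      rw [mulVec_mulVec, nonsing_inv_mul _ hG, one_mulVec]
    refine ⟨(E * Eᴴ) *ᵥ u, fun h0 => hu ?_, ?_⟩
    · rw [← hu', h0, mulVec_zero]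
    · rw [← mulVec_mulVec, hu', h, key]

lemma dotProduct_mulVec_le_of_generalized_eigenvalue_le {A E : Matrix m m ℝ}
    (hA : A.IsHermitian) (hE : IsUnit E.det) {c : ℝ}
    (hc : ∀ (r : ℝ) (u : m → ℝ), u ≠ 0 → A *ᵥ u = r • (E *ᵥ (u ᵥ* E)) → r ≤ c) (u : m → ℝ) :
    u ⬝ᵥ A *ᵥ u ≤ c * ((u ᵥ* E) ⬝ᵥ (u ᵥ* E)) := by
  have hET : IsUnit (Eᴴ).det := by simpa [Matrix.det_conjTranspose] using hE
  set M : Matrix m m ℝ := c • 1 - E⁻¹ * A * (E⁻¹)ᴴ with hM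
  have hMH : M.IsHermitian :=
    (isHermitian_one.smul (IsSelfAdjoint.all c)).sub (isHermitian_mul_mul_conjTranspose _ hA)
  have hvE : ∀ w : m → ℝ, ((E⁻¹)ᴴ *ᵥ w) ᵥ* E = w := fun w => by
    rw [← mulVec_transpose, ← conjTranspose_eq_transpose_of_trivial, mulVec_mulVec,
      ← conjTranspose_mul, nonsing_inv_mul _ hE, conjTranspose_one, one_mulVec]
  have hpos : M.PosSemidef := by
    rw [hMH.posSemidef_iff_eigenvalues_nonneg]
    intro i
    set w : m → ℝ := (hMH.eigenvectorBasis i).ofLp with hw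
    have hw0 : w ≠ 0 := fun h0 => (hMH.eigenvectorBasis.orthonormal.ne_zero i)
      (WithLp.ofLp_injective 2 h0)
    have hMw : M *ᵥ w = hMH.eigenvalues i • w := hMH.mulVec_eigenvectorBasis i
    have h := hc (c - hMH.eigenvalues i) ((E⁻¹)ᴴ *ᵥ w)
      (fun h0 => hw0 (by rw [← hvE w, h0, zero_vecMul])) (by
        rw [hvE, ← mulVec_smul, sub_smul, ← hMw, hM, sub_mulVec, smul_mulVec, one_mulVec,
          sub_sub_cancel, mulVec_mulVec, mulVec_mulVec, ← Matrix.mul_assoc, ← Matrix.mul_assoc,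
          mul_nonsing_inv _ hE, Matrix.one_mul])
    simp only [Pi.zero_apply]
    linarith
  have hu : (E⁻¹)ᴴ *ᵥ (u ᵥ* E) = u := by
    rw [← mulVec_transpose, ← conjTranspose_eq_transpose_of_trivial, mulVec_mulVec,
      ← conjTranspose_mul, mul_nonsing_inv _ hE, conjTranspose_one, one_mulVec]
  have h := hpos.dotProduct_mulVec_nonneg (u ᵥ* E)
  rw [hM, sub_mulVec, smul_mulVec, one_mulVec, ← mulVec_mulVec, hu, ← mulVec_mulVec,
    dotProduct_sub, dotProduct_smul, star_trivial, dotProduct_mulVec _ E⁻¹, vecMul_vecMul,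
    mul_nonsing_inv _ hE, vecMul_one, smul_eq_mul] at h
  linarith

end Matrices

/-- If the Gram matrix `K[X]` and the matrix `E = [e k (x j)]` are nonsingular, then the
distance between the sampling subspace `S_X = span{K(x j, ·)}` and the optimal subspace
`S_T = span{e k}`, measured as the operator norm `‖P - Q‖` of the difference of the
orthogonal projections, equals `√(1 - 1/λ_max(K[X]ᵀ (E Eᴴ)⁻¹))`. -/
theorem stmt_14 {X : Type*} {H : Type*} [NormedAddCommGroup H] [InnerProductSpace ℝ H]
    (k : X → H) (K : X → X → ℝ) (hK : ∀ x y : X, K x y = ⟪k x, k y⟫)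
    {n : ℕ} (e : Fin n → H) (he : Orthonormal ℝ e) (x : Fin n → X)
    (KX Emat : Matrix (Fin n) (Fin n) ℝ)
    (hKX : ∀ j l : Fin n, KX j l = K (x j) (x l))
    (hE : ∀ j l : Fin n, Emat j l = ⟪e l, k (x j)⟫)
    (hKXu : IsUnit KX.det) (hEu : IsUnit Emat.det)
    (P Q : H →L[ℝ] H)
    (hP : ∀ v : H, P v ∈ Submodule.span ℝ (Set.range fun j : Fin n => k (x j)) ∧
      ∀ w ∈ Submodule.span ℝ (Set.range fun j : Fin n => k (x j)), ⟪v - P v, w⟫ = 0)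
    (hQ : ∀ v : H, Q v ∈ Submodule.span ℝ (Set.range e) ∧
      ∀ w ∈ Submodule.span ℝ (Set.range e), ⟪v - Q v, w⟫ = 0)
    (c : ℝ)
    (hc : IsGreatest
      {r : ℝ | ∃ v : Fin n → ℝ, v ≠ 0 ∧
        (KX.transpose * (Emat * Emat.conjTranspose)⁻¹).mulVec v = r • v} c) :
    ‖P - Q‖ = Real.sqrt (1 - 1 / c) := by
  have hP' : IsOrthProj (Submodule.span ℝ (Set.range fun j : Fin n => k (x j))) P := hP
  have hQ' : IsOrthProj (Submodule.span ℝ (Set.range e)) Q := hQ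
  have hA : KX.IsHermitian := by
    ext j l
    simp [hKX, hK, real_inner_comm]
  have hAt : KX.transpose = KX := by
    rw [← Matrix.conjTranspose_eq_transpose_of_trivial, hA.eq]
  rw [hAt] at hc
  simp only [exists_mulVec_mul_inv_eq_smul_iff KX Emat hEu] at hc
  set F : (Fin n → ℝ) → H := fun u => ∑ j, u j • k (x j) with hF
  have hFU : ∀ u, F u ∈ Submodule.span ℝ (Set.range fun j : Fin n => k (x j)) := fun u =>
    Submodule.sum_mem _ fun j _ => Submodule.smul_mem _ _ (Submodule.subset_span ⟨j, rfl⟩)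
  have hnF : ∀ u, ‖F u‖ ^ 2 = u ⬝ᵥ KX.mulVec u := fun u => by
    rw [← real_inner_self_eq_norm_sq]
    simp only [hF, sum_inner, inner_sum, real_inner_smul_left, real_inner_smul_right,
      dotProduct, Matrix.mulVec, hKX, hK, Finset.mul_sum]
    exact Finset.sum_congr rfl fun i _ => Finset.sum_congr rfl fun j _ => by
      rw [real_inner_comm]
      ring
  have hQF : ∀ u, Q (F u) = ∑ l, Matrix.vecMul u Emat l • e l := fun u => by
    refine hQ'.apply_eq
      (Submodule.sum_mem _ fun j _ => Submodule.smul_mem _ _ (Submodule.subset_span ⟨j, rfl⟩))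
      fun w hw => ?_
    induction hw using Submodule.span_induction with
    | mem w hw =>
      obtain ⟨l, rfl⟩ := hw
      rw [he.inner_left_fintype, real_inner_comm]
      simp [hF, inner_sum, real_inner_smul_right, Matrix.vecMul, dotProduct, hE]
    | zero => simp
    | add a b _ _ ha hb => rw [inner_add_right, inner_add_right, ha, hb]
    | smul t a _ ha => rw [real_inner_smul_right, real_inner_smul_right, ha]
  have hnQF : ∀ u, ‖Q (F u)‖ ^ 2 = Matrix.vecMul u Emat ⬝ᵥ Matrix.vecMul u Emat := fun u => by
    rw [hQF, ← real_inner_self_eq_norm_sq, he.inner_sum]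
    simp [dotProduct]
  refine hP'.norm_sub_eq hQ' ?_ ?_ ?_
  · intro f hf
    obtain ⟨u, rfl⟩ := (Submodule.mem_span_range_iff_exists_fun ℝ).1 hf
    change ‖F u‖ ^ 2 ≤ c * ‖Q (F u)‖ ^ 2
    rw [hnF, hnQF]
    exact dotProduct_mulVec_le_of_generalized_eigenvalue_le hA hEu
      (fun r w hw h => hc.2 ⟨w, hw, h⟩) u
  · intro g hg
    obtain ⟨b, rfl⟩ := (Submodule.mem_span_range_iff_exists_fun ℝ).1 hg
    refine ⟨F (Matrix.vecMul b Emat⁻¹), hFU _, ?_⟩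
    rw [hQF, Matrix.vecMul_vecMul, Matrix.nonsing_inv_mul _ hEu, Matrix.vecMul_one]
  · obtain ⟨u, hu, h⟩ := hc.1
    have hEq : ‖F u‖ ^ 2 = c * ‖Q (F u)‖ ^ 2 := by
      rw [hnF, hnQF, h, dotProduct_smul, Matrix.dotProduct_mulVec, smul_eq_mul]
    refine ⟨F u, hFU u, fun h0 => hu ?_, hEq⟩
    have h1 := hnQF u
    rw [h0, map_zero, norm_zero, zero_pow two_ne_zero, eq_comm, dotProduct_self_eq_zero] at h1
    rw [← Matrix.vecMul_one u, ← Matrix.mul_nonsing_inv _ hEu, ← Matrix.vecMul_vecMul, h1,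
      Matrix.zero_vecMul]
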